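/- arXiv:0804.0809 — 4 statements merged into one kernel-verified Lean document; each statement's English description precedes it below -/
import Mathlib

section
/- Let a, b be integers with 0 < a < b and gcd(a,b) = 1, let β ∈ ℂ and k ∈ {0,…,a−1}, set λ := (β−bk)/a, and define c_m := (∏_{r=0}^{bm−1}(λ−r)) / (∏_{i=1}^{am}(k+i)) for m ∈ ℕ. Then: (1) if λ ∈ ℕ (which happens for exactly one k ∈ {0,…,a−1} when β ∈ aℕ + bℕ), then c_m = 0 for all m with bm > λ, so Σ_m c_m z^m is a polynomial; (2) if λ ∉ ℕ, then c_m ≠ 0 for all m, and the power series Σ_{m≥0} (c_m/((am)!)^{s−1}) z^m has positive radius of convergence for every real s ≥ b/a and radius of convergence 0 for every real 1 ≤ s < b/a. (That is, the Γ-series φ_{v^k,p}, v^k = (λ,k), has Gevrey index exactly b/a along x_2 = 0 at points p = (ε,0) with ε ≠ 0.) -/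
/-- The coefficient `c_m = Γ[v^k;u(m)] = (∏_{r=0}^{bm−1}(λ−r)) / (∏_{i=1}^{am}(k+i))`
with `λ = (β−bk)/a`, of the Γ-series `φ_{v^k}` of the system `M_{(a b)}(β)` along
`x_2 = 0`. -/
noncomputable def gammaCoef (a b k : ℕ) (β : ℂ) (m : ℕ) : ℂ :=
  (∏ r ∈ Finset.range (b * m), ((β - (b : ℂ) * (k : ℂ)) / (a : ℂ) - (r : ℂ))) /
    (∏ i ∈ Finset.range (a * m), ((k : ℂ) + (i : ℂ) + 1))

open Filter Topology Finset in
theorem tendsto_prod_norm_linear_div_pow (z : ℂ) (w : ℕ → ℂ) (n : ℕ) :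
    Tendsto (fun m : ℕ => (∏ j ∈ range n, ‖z * m + w j‖) / (m : ℝ) ^ n) atTop
      (𝓝 (‖z‖ ^ n)) := by
  have factor (j : ℕ) : Tendsto (fun m : ℕ => ‖z * m + w j‖ / (m : ℝ)) atTop (𝓝 ‖z‖) := by
    have inv_zero : Tendsto (fun m : ℕ => w j / (m : ℂ)) atTop (𝓝 0) :=
      tendsto_const_div_atTop_nhds_zero_nat (w j)
    have lim := (inv_zero.const_add z).norm
    rw [add_zero] at lim
    refine lim.congr' ?_
    filter_upwards [eventually_gt_atTop 0] with m hm
    have hm' : (m : ℂ) ≠ 0 := by exact_mod_cast hm.ne'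
    rw [← Complex.norm_natCast m, ← norm_div, add_div, mul_div_cancel_right₀ _ hm']
  have lim := tendsto_finsetProd (range n) fun j _ => factor j
  simpa [prod_div_distrib] using lim

open Finset in
theorem gammaCoef_ne_zero (a b k : ℕ) (β : ℂ)
    (h : ∀ N : ℕ, (β - (b : ℂ) * (k : ℂ)) / (a : ℂ) ≠ (N : ℂ)) (m : ℕ) :
    gammaCoef a b k β m ≠ 0 := by
  refine div_ne_zero (prod_ne_zero_iff.2 fun r _ => sub_ne_zero.2 (h r))
    (prod_ne_zero_iff.2 fun i _ => ?_)
  exact_mod_cast Nat.succ_ne_zero (k + i)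

open Finset in
theorem gammaCoef_eq_zero (a b k : ℕ) (β : ℂ) (N : ℕ)
    (h : (β - (b : ℂ) * (k : ℂ)) / (a : ℂ) = (N : ℂ)) (m : ℕ) (hm : N < b * m) :
    gammaCoef a b k β m = 0 := by
  rw [gammaCoef, prod_eq_zero (mem_range.2 hm) (by rw [h, sub_self]), zero_div]

theorem existsUnique_lt_div_eq_natCast (a b : ℕ) (ha : 0 < a) (hgcd : Nat.gcd a b = 1) (β : ℂ)
    (h : ∃ u v : ℕ, β = (a : ℂ) * (u : ℂ) + (b : ℂ) * (v : ℂ)) :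
    ∃! k : ℕ, k < a ∧ ∃ N : ℕ, (β - (b : ℂ) * (k : ℂ)) / (a : ℂ) = (N : ℂ) := by
  obtain ⟨u, v, rfl⟩ := h
  have ha' : (a : ℂ) ≠ 0 := by exact_mod_cast ha.ne'
  refine ⟨v % a, ⟨Nat.mod_lt _ ha, u + b * (v / a), ?_⟩, ?_⟩
  · rw [div_eq_iff ha']
    have hv : (v : ℂ) = a * ((v / a : ℕ) : ℂ) + ((v % a : ℕ) : ℂ) := by
      exact_mod_cast (Nat.div_add_mod v a).symm
    push_cast
    linear_combination (b : ℂ) * hv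
  · rintro k ⟨hk, N, hN⟩
    rw [div_eq_iff ha'] at hN
    have eq : (b : ℤ) * (v - k) = a * (N - u) := by
      have : (b : ℂ) * (v - k) = a * (N - u) := by linear_combination hN
      exact_mod_cast this
    have dvd : (a : ℤ) ∣ v - k :=
      IsCoprime.dvd_of_dvd_mul_left (Nat.isCoprime_iff_coprime.2 hgcd) ⟨_, eq⟩
    have modEq : k ≡ v [MOD a] := (Nat.modEq_iff_dvd).2 dvd
    rw [← modEq, Nat.mod_eq_of_lt hk]

/-- The factor by which the norms of the `ρ_s`-transformed coefficients grow from index `m`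
to index `m + 1`. -/
noncomputable def gevreyRatio (a b k : ℕ) (β : ℂ) (s : ℝ) (m : ℕ) : ℝ :=
  (∏ j ∈ Finset.range b, ‖-(b : ℂ) * m + ((β - b * k) / a - j)‖) /
    (∏ i ∈ Finset.range a, ‖(a : ℂ) * m + (k + i + 1)‖) /
    (∏ i ∈ Finset.range a, ‖(a : ℂ) * m + (i + 1)‖) ^ (s - 1)

open Finset in
theorem norm_gammaCoef_succ (a b k : ℕ) (β : ℂ) (m : ℕ) :
    ‖gammaCoef a b k β (m + 1)‖ = ‖gammaCoef a b k β m‖ *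
      ((∏ j ∈ range b, ‖-(b : ℂ) * m + ((β - b * k) / a - j)‖) /
        (∏ i ∈ range a, ‖(a : ℂ) * m + (k + i + 1)‖)) := by
  rw [gammaCoef, gammaCoef, mul_add_one, mul_add_one, prod_range_add, prod_range_add,
    mul_div_mul_comm, norm_mul, norm_div (∏ j ∈ range b, _), norm_prod, norm_prod]
  congr 2
  · refine prod_congr rfl fun j _ => ?_
    push_cast
    ring_nf
  · refine prod_congr rfl fun j _ => ?_
    push_cast
    ring_nf

open Finset in
theorem factorial_mul_succ_eq_mul_prod_norm (a m : ℕ) :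
    ((a * (m + 1)).factorial : ℝ) =
      (a * m).factorial * ∏ i ∈ range a, ‖(a : ℂ) * m + (i + 1)‖ := by
  rw [mul_add_one, ← Nat.factorial_mul_ascFactorial, Nat.ascFactorial_eq_prod_range]
  push_cast
  congr 1
  refine prod_congr rfl fun i _ => ?_
  have : (a : ℂ) * m + (i + 1) = ((a * m + 1 + i : ℕ) : ℂ) := by
    push_cast
    ring
  rw [this, Complex.norm_natCast]
  push_cast
  ring

theorem gevreyTerm_succ (a b k : ℕ) (β : ℂ) (s r : ℝ) (m : ℕ) :
    ‖gammaCoef a b k β (m + 1)‖ / ((a * (m + 1)).factorial : ℝ) ^ (s - 1) * r ^ (m + 1) =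
      gevreyRatio a b k β s m * r *
        (‖gammaCoef a b k β m‖ / ((a * m).factorial : ℝ) ^ (s - 1) * r ^ m) := by
  rw [norm_gammaCoef_succ, factorial_mul_succ_eq_mul_prod_norm,
    Real.mul_rpow (by positivity) (by positivity), mul_div_mul_comm, gevreyRatio, pow_succ]
  ring

theorem gevreyRatio_nonneg (a b k : ℕ) (β : ℂ) (s : ℝ) (m : ℕ) :
    0 ≤ gevreyRatio a b k β s m := by
  unfold gevreyRatio
  positivity

open Filter Topology Finset in
theorem exists_tendsto_gevreyRatio_div_rpow (a b k : ℕ) (ha : 0 < a) (hb : 0 < b) (β : ℂ)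
    (s : ℝ) :
    ∃ L : ℝ, 0 < L ∧ Tendsto (fun m : ℕ => gevreyRatio a b k β s m / (m : ℝ) ^ (b - a * s))
      atTop (𝓝 L) := by
  have num := tendsto_prod_norm_linear_div_pow (-(b : ℂ)) (fun j => (β - b * k) / a - j) b
  have den := tendsto_prod_norm_linear_div_pow (a : ℂ) (fun i => k + i + 1) a
  have fac := tendsto_prod_norm_linear_div_pow (a : ℂ) (fun i => i + 1) a
  rw [norm_neg] at num
  rw [Complex.norm_natCast] at num den fac
  have pos_a : (0 : ℝ) < (a : ℝ) ^ a := by positivity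
  have pos_b : (0 : ℝ) < (b : ℝ) ^ b := by positivity
  refine ⟨(b : ℝ) ^ b / (a : ℝ) ^ a / ((a : ℝ) ^ a) ^ (s - 1), by positivity, ?_⟩
  refine ((num.div den pos_a.ne').div (fac.rpow_const (Or.inl pos_a.ne'))
    (Real.rpow_pos_of_pos pos_a _).ne').congr' ?_
  filter_upwards [eventually_gt_atTop 0] with m hm
  have hm' : (0 : ℝ) < m := by exact_mod_cast hm
  have exponent : (m : ℝ) ^ (b - a * s) = (m : ℝ) ^ b / (m : ℝ) ^ a / ((m : ℝ) ^ a) ^ (s - 1) := by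
    rw [← Real.rpow_natCast, ← Real.rpow_natCast, ← Real.rpow_mul hm'.le, ← Real.rpow_sub hm',
      ← Real.rpow_sub hm']
    ring_nf
  simp only [Pi.div_apply]
  rw [exponent, gevreyRatio, Real.div_rpow (by positivity) (by positivity),
    div_div_div_comm _ ((m : ℝ) ^ b), div_div_div_comm]

open Filter in
theorem exists_summable_gevreyTerm (a b k : ℕ) (ha : 0 < a) (hb : 0 < b) (β : ℂ) (s : ℝ)
    (hs : (b : ℝ) / (a : ℝ) ≤ s) :
    ∃ r : ℝ, 0 < r ∧ Summable (fun m : ℕ =>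
      ‖gammaCoef a b k β m‖ / ((a * m).factorial : ℝ) ^ (s - 1) * r ^ m) := by
  obtain ⟨L, hL, lim⟩ := exists_tendsto_gevreyRatio_div_rpow a b k ha hb β s
  have exponent : (b : ℝ) - a * s ≤ 0 := by
    rw [div_le_iff₀' (by positivity)] at hs
    linarith
  refine ⟨1 / (4 * L), by positivity,
    summable_of_ratio_norm_eventually_le (r := 1 / 2) (by norm_num) ?_⟩
  filter_upwards [lim.eventually_le_const (by linarith : L < 2 * L), eventually_ge_atTop 1]
    with m hm hm1
  have hm1' : (1 : ℝ) ≤ m := by exact_mod_cast hm1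
  rw [gevreyTerm_succ, norm_mul]
  refine mul_le_mul_of_nonneg_right ?_ (norm_nonneg _)
  rw [Real.norm_of_nonneg (mul_nonneg (gevreyRatio_nonneg ..) (by positivity))]
  rw [div_le_iff₀ (by positivity)] at hm
  have bound : gevreyRatio a b k β s m ≤ 2 * L :=
    hm.trans (mul_le_of_le_one_right (by positivity)
      (Real.rpow_le_one_of_one_le_of_nonpos hm1' exponent))
  calc gevreyRatio a b k β s m * (1 / (4 * L)) ≤ 2 * L * (1 / (4 * L)) := by gcongr
    _ = 1 / 2 := by
      field_simp
      norm_num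

open Filter in
theorem not_summable_gevreyTerm (a b k : ℕ) (ha : 0 < a) (hb : 0 < b) (β : ℂ)
    (h : ∀ N : ℕ, (β - (b : ℂ) * (k : ℂ)) / (a : ℂ) ≠ (N : ℂ)) (s : ℝ)
    (hs : s < (b : ℝ) / (a : ℝ)) (r : ℝ) (hr : 0 < r) :
    ¬ Summable (fun m : ℕ =>
      ‖gammaCoef a b k β m‖ / ((a * m).factorial : ℝ) ^ (s - 1) * r ^ m) := by
  obtain ⟨L, hL, lim⟩ := exists_tendsto_gevreyRatio_div_rpow a b k ha hb β s
  have exponent : 0 < (b : ℝ) - a * s := by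
    rw [lt_div_iff₀' (by positivity)] at hs
    linarith
  have growth := (tendsto_rpow_atTop exponent).comp (tendsto_natCast_atTop_atTop (R := ℝ))
  refine not_summable_of_ratio_norm_eventually_ge (r := 2) (by norm_num)
    (Eventually.frequently (Eventually.of_forall fun m => ?_)) ?_
  · have := norm_pos_iff.2 (gammaCoef_ne_zero a b k β h m)
    exact norm_ne_zero_iff.2 (by positivity)
  · filter_upwards [lim.eventually_const_le (by linarith : L / 2 < L),
      growth.eventually_ge_atTop (4 / (L * r)), eventually_gt_atTop 0] with m hm hgrow hm0
    have hm0' : (0 : ℝ) < m := by exact_mod_cast hm0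
    rw [gevreyTerm_succ, norm_mul (_ * r)]
    refine mul_le_mul_of_nonneg_right ?_ (norm_nonneg _)
    rw [Real.norm_of_nonneg (mul_nonneg (gevreyRatio_nonneg ..) hr.le)]
    rw [le_div_iff₀ (by positivity)] at hm
    calc (2 : ℝ) = L / 2 * (4 / (L * r)) * r := by
          field_simp
          norm_num
      _ ≤ L / 2 * (m : ℝ) ^ (b - a * s) * r := by
          gcongr
          exact hgrow
      _ ≤ gevreyRatio a b k β s m * r := by gcongr

/-- with `λ = (β−bk)/a`:
(1) if `λ ∈ ℕ` then `c_m = 0` whenever `bm > λ` (so the series is a polynomial), and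
such a `k` is unique in `{0,…,a−1}` when `β ∈ aℕ + bℕ`;
(2) if `λ ∉ ℕ` then all `c_m ≠ 0`, and `Σ_m (c_m/((am)!)^{s−1}) z^m` has positive
radius of convergence for every real `s ≥ b/a` and radius of convergence `0` for
every real `1 ≤ s < b/a`; i.e. `φ_{v^k,p}` has Gevrey index exactly `b/a`. -/
theorem gammaSeries_gevrey_index (a b k : ℕ) (ha : 0 < a) (hab : a < b)
    (hgcd : Nat.gcd a b = 1) (hk : k < a) (β : ℂ) :
    ((∀ N : ℕ, (β - (b : ℂ) * (k : ℂ)) / (a : ℂ) = (N : ℂ) →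
        ∀ m : ℕ, N < b * m → gammaCoef a b k β m = 0) ∧
      ((∃ u v : ℕ, β = (a : ℂ) * (u : ℂ) + (b : ℂ) * (v : ℂ)) →
        ∃! k' : ℕ, k' < a ∧ ∃ N : ℕ, (β - (b : ℂ) * (k' : ℂ)) / (a : ℂ) = (N : ℂ))) ∧
    ((∀ N : ℕ, (β - (b : ℂ) * (k : ℂ)) / (a : ℂ) ≠ (N : ℂ)) →
      (∀ m : ℕ, gammaCoef a b k β m ≠ 0) ∧
      (∀ s : ℝ, (b : ℝ) / (a : ℝ) ≤ s → ∃ r : ℝ, 0 < r ∧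
        Summable (fun m : ℕ =>
          ‖gammaCoef a b k β m‖ / ((a * m).factorial : ℝ) ^ (s - 1) * r ^ m)) ∧
      (∀ s : ℝ, 1 ≤ s → s < (b : ℝ) / (a : ℝ) → ∀ r : ℝ, 0 < r →
        ¬ Summable (fun m : ℕ =>
          ‖gammaCoef a b k β m‖ / ((a * m).factorial : ℝ) ^ (s - 1) * r ^ m))) := by
  have hb : 0 < b := ha.trans hab
  exact ⟨⟨gammaCoef_eq_zero a b k β, existsUnique_lt_div_eq_natCast a b ha hgcd β⟩,
    fun h => ⟨gammaCoef_ne_zero a b k β h, exists_summable_gevreyTerm a b k ha hb β,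
      fun s _ hs => not_summable_gevreyTerm a b k ha hb β h s hs⟩⟩
end

section
/- Fix integers 0 < a < b, β ∈ ℂ, k ∈ {0,…,a−1}, and a real s ≥ b/a. Let (f_m)_{m∈ℕ} and (h_m)_{m∈ℕ} be sequences of complex numbers satisfying the recurrence h_{m+1} = (1/∏_{j=0}^{a−1}(k + a(m+1) − j)) · ( (∏_{j=0}^{b−1}((β−bk)/a − bm − j)) · h_m − f_m ) for all m ∈ ℕ. If there exist C̃, D̃ > 0 with |f_m| ≤ C̃ · D̃^m · ((k+am)!)^{s−1} for all m, then there exist C, D > 0 with |h_m| ≤ C · D^m · ((k+am)!)^{s−1} for all m. (This is the growth estimate showing that the formal solution h of P(h) = f̂, E(h) = 0 is again Gevrey of order s.) -/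
theorem Nat.cast_descFactorial_eq_prod_sub {n a : ℕ} (h : a ≤ n) :
    (n.descFactorial a : ℂ) = ∏ j ∈ Finset.range a, ((n : ℂ) - (j : ℂ)) := by
  rw [Nat.descFactorial_eq_prod_range, Nat.cast_prod]
  refine Finset.prod_congr rfl fun j hj => ?_
  rw [Nat.cast_sub ((Finset.mem_range.mp hj).le.trans h)]

theorem norm_prod_sub_le_mul_pow (c : ℂ) (b m : ℕ) :
    ‖∏ j ∈ Finset.range b, (c - (b : ℂ) * (m : ℂ) - (j : ℂ))‖
      ≤ (‖c‖ + b) ^ b * ((m : ℝ) + 1) ^ b := by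
  rw [norm_prod, ← mul_pow]
  refine (Finset.prod_le_prod (g := fun _ => (‖c‖ + b) * ((m : ℝ) + 1))
    (fun _ _ => norm_nonneg _) fun j hj => ?_).trans_eq (by simp)
  have hj' : (j : ℝ) ≤ b := by exact_mod_cast (Finset.mem_range.mp hj).le
  calc ‖c - (b : ℂ) * (m : ℂ) - (j : ℂ)‖
      ≤ ‖c‖ + ‖(b : ℂ) * (m : ℂ)‖ + ‖(j : ℂ)‖ :=
        (norm_sub_le _ _).trans (by gcongr; exact norm_sub_le _ _)
    _ = ‖c‖ + b * m + j := by simp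
    _ ≤ (‖c‖ + b) * ((m : ℝ) + 1) := by
        nlinarith [mul_nonneg (norm_nonneg c) (Nat.cast_nonneg (α := ℝ) m)]

theorem pow_le_rpow_of_pow_le {a b : ℕ} (ha : 0 < a) {s x q : ℝ} (hx : 0 ≤ x)
    (hq : 1 ≤ q) (hxq : x ^ a ≤ q) (hs : (b : ℝ) / (a : ℝ) ≤ s) : x ^ b ≤ q ^ s := by
  have ha' : (a : ℝ) ≠ 0 := by exact_mod_cast ha.ne'
  calc x ^ b = (x ^ a) ^ ((b : ℝ) / (a : ℝ)) := by
        rw [← Real.rpow_natCast x a, ← Real.rpow_mul hx, mul_div_cancel₀ _ ha',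
          Real.rpow_natCast]
    _ ≤ q ^ ((b : ℝ) / (a : ℝ)) := by gcongr
    _ ≤ q ^ s := Real.rpow_le_rpow_of_exponent_le hq hs


/-- growth estimate for the recurrence
`h_{m+1} = (1/(k+a(m+1))_a)·((λ_k − bm)_b · h_m − f_m)` (falling factorials),
`λ_k = (β−bk)/a`, arising from `P(h) = f̂`, `E(h) = 0`: if
`|f_m| ≤ C̃ D̃^m ((k+am)!)^{s−1}` for some `C̃, D̃ > 0`, then
`|h_m| ≤ C D^m ((k+am)!)^{s−1}` for some `C, D > 0`; so `h` is again Gevrey of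
order `s` when `s ≥ b/a`. -/
theorem recurrence_gevrey_estimate (a b k : ℕ) (ha : 0 < a) (hab : a < b)
    (hk : k < a) (β : ℂ) (s : ℝ) (hs : (b : ℝ) / (a : ℝ) ≤ s)
    (f h : ℕ → ℂ)
    (hrec : ∀ m : ℕ, h (m + 1) =
      (∏ j ∈ Finset.range a, (((k : ℂ) + (a : ℂ) * ((m : ℂ) + 1)) - (j : ℂ)))⁻¹ *
        ((∏ j ∈ Finset.range b,
            ((β - (b : ℂ) * (k : ℂ)) / (a : ℂ) - (b : ℂ) * (m : ℂ) - (j : ℂ))) * h m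
          - f m))
    (Ct Dt : ℝ) (hCt : 0 < Ct) (hDt : 0 < Dt)
    (hf : ∀ m : ℕ, ‖f m‖ ≤ Ct * Dt ^ m * ((k + a * m).factorial : ℝ) ^ (s - 1)) :
    ∃ C D : ℝ, 0 < C ∧ 0 < D ∧
      ∀ m : ℕ, ‖h m‖ ≤ C * D ^ m * ((k + a * m).factorial : ℝ) ^ (s - 1) := by
  have hs1 : 0 ≤ s - 1 := by
    have : (1 : ℝ) ≤ (b : ℝ) / (a : ℝ) := by
      rw [le_div_iff₀ (by exact_mod_cast ha), one_mul]
      exact_mod_cast hab.le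
    linarith
  set c : ℂ := (β - (b : ℂ) * (k : ℂ)) / (a : ℂ)
  set K : ℝ := (‖c‖ + b) ^ b
  have hK : 0 ≤ K := by positivity
  have hD : 0 < K + 1 + Dt := by positivity
  refine ⟨‖h 0‖ + Ct, K + 1 + Dt, by positivity, hD, fun m => ?_⟩
  induction m with
  | zero =>
    have h1 : (1 : ℝ) ≤ ((k + a * 0).factorial : ℝ) ^ (s - 1) :=
      Real.one_le_rpow (by exact_mod_cast Nat.factorial_pos _) hs1
    rw [pow_zero, mul_one]
    nlinarith [norm_nonneg (h 0)]
  | succ m ih =>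
    set C : ℝ := ‖h 0‖ + Ct
    set D : ℝ := K + 1 + Dt
    set F : ℝ := ((k + a * m).factorial : ℝ)
    have hCtC : Ct ≤ C := le_add_of_nonneg_left (norm_nonneg _)
    have hC : 0 < C := hCt.trans_le hCtC
    have han : a ≤ k + a * (m + 1) := by nlinarith
    set Q : ℕ := (k + a * (m + 1)).descFactorial a
    have hprod : ∏ j ∈ Finset.range a, (((k : ℂ) + (a : ℂ) * ((m : ℂ) + 1)) - (j : ℂ)) = Q := by
      rw [Nat.cast_descFactorial_eq_prod_sub han]
      push_cast
      rfl
    have hfact : ((k + a * (m + 1)).factorial : ℝ) = F * Q := by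
      have := Nat.factorial_mul_descFactorial han
      rw [show k + a * (m + 1) - a = k + a * m by rw [mul_add]; omega] at this
      rw [← this, Nat.cast_mul]
    have hpowQ : ((m : ℝ) + 1) ^ a ≤ Q := by
      have h1 := Nat.pow_sub_le_descFactorial (k + a * (m + 1)) a
      have h2 : m + 1 ≤ k + a * (m + 1) + 1 - a := by
        have : m ≤ a * m := Nat.le_mul_of_pos_left m ha
        rw [mul_add]
        omega
      exact_mod_cast (Nat.pow_le_pow_left h2 a).trans h1
    have hQ : (1 : ℝ) ≤ Q := (one_le_pow₀ (by simp)).trans hpowQ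
    have hQ0 : (0 : ℝ) < Q := one_pos.trans_le hQ
    have hP : ‖∏ j ∈ Finset.range b, (c - (b : ℂ) * (m : ℂ) - (j : ℂ))‖ ≤ K * (Q : ℝ) ^ s :=
      (norm_prod_sub_le_mul_pow c b m).trans
        (by gcongr; exact pow_le_rpow_of_pow_le ha (by positivity) hQ hpowQ hs)
    have hfm : ‖f m‖ ≤ C * D ^ m * F ^ (s - 1) :=
      (hf m).trans (by gcongr; exact le_add_of_nonneg_left (by positivity))
    have hQs : (1 : ℝ) ≤ (Q : ℝ) ^ s := Real.one_le_rpow hQ (by linarith)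
    have hB : 0 ≤ C * D ^ m * F ^ (s - 1) := by positivity
    rw [hrec m, hprod, norm_mul, norm_inv, Complex.norm_natCast, hfact,
      Real.mul_rpow (by positivity) hQ0.le]
    calc (Q : ℝ)⁻¹ * ‖(∏ j ∈ Finset.range b, (c - (b : ℂ) * (m : ℂ) - (j : ℂ))) * h m - f m‖
        ≤ (Q : ℝ)⁻¹ * (K * (Q : ℝ) ^ s * (C * D ^ m * F ^ (s - 1))
            + (Q : ℝ) ^ s * (C * D ^ m * F ^ (s - 1))) := by
          gcongr
          refine (norm_sub_le _ _).trans (add_le_add ?_ ?_)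
          · rw [norm_mul]
            gcongr
          · exact hfm.trans (le_mul_of_one_le_left hB hQs)
      _ = C * D ^ m * (K + 1) * (F ^ (s - 1) * (Q : ℝ) ^ (s - 1)) := by
          rw [Real.rpow_sub_one hQ0.ne']
          ring
      _ ≤ C * D ^ m * D * (F ^ (s - 1) * (Q : ℝ) ^ (s - 1)) := by
          gcongr
          exact le_add_of_nonneg_right hDt.le
      _ = C * D ^ (m + 1) * (F ^ (s - 1) * (Q : ℝ) ^ (s - 1)) := by ring
end

section
/- Let n ≥ 4 and let a_2 < a_3 < ⋯ < a_{n−1} be integers with a_2 > 1, and let j ∈ ℕ. Then there exist constants C > 0 and r > 0 such that for all m_2, …, m_{n−2}, m_{n−1} ∈ ℕ satisfying Σ_{i=2}^{n−2} a_i m_i ≤ j + a_{n−1} m_{n−1}, one has m_{n−1}! / ( m_2! ⋯ m_{n−2}! · (j + a_{n−1} m_{n−1} − Σ_{i=2}^{n−2} a_i m_i)! ) ≤ C^{m_{n−1}} / (m_{n−1}!)^r. (This is the key factorial estimate in the proof that the Γ-series φ_{v^j} of the system M_{(1 a_2 ⋯ a_n)}(β) are Gevrey of order a_n/a_{n−1}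 along x_n = 0 at points with x_{n−1} ≠ 0.) -/
open Finset in
/-- A multinomial coefficient with `#s` parts is at most `#s ^ (∑ i ∈ s, f i)`. -/
theorem factorial_sum_le_card_pow_mul_prod_factorial {ι : Type*} (s : Finset ι) (f : ι → ℕ) :
    (∑ i ∈ s, f i).factorial ≤ s.card ^ (∑ i ∈ s, f i) * ∏ i ∈ s, (f i).factorial := by
  classical
  rw [← Nat.multinomial_spec, mul_comm]
  gcongr
  set g : ι → ℕ := fun i ↦ if i ∈ s then f i else 0 with hg
  have hfg : ∀ i ∈ s, f i = g i := fun i hi ↦ by simp [hg, hi]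
  have hmem : g ∈ piAntidiag s (∑ i ∈ s, f i) :=
    mem_piAntidiag.2 ⟨(sum_congr rfl hfg).symm, fun i hi ↦ by
      by_contra h
      exact hi (if_neg h)⟩
  have h := sum_pow_eq_sum_piAntidiag s (fun _ ↦ (1 : ℕ)) (∑ i ∈ s, f i)
  simp only [sum_const, smul_eq_mul, mul_one, one_pow, prod_const_one, Nat.cast_id] at h
  rw [h, Nat.multinomial_congr hfg]
  exact single_le_sum (f := fun k ↦ Nat.multinomial s k) (fun _ _ ↦ Nat.zero_le _) hmem

theorem factorial_pow_le_of_mul_le {A M b N : ℕ} (h : A * M ≤ b * N) :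
    M.factorial ^ A ≤ (b ^ N * N.factorial) ^ b := by
  have h₁ : M.factorial ^ A ≤ (A * M).factorial := by
    have := Nat.prod_factorial_dvd_factorial_sum (Finset.range A) (fun _ ↦ M)
    simp only [Finset.prod_const, Finset.sum_const, Finset.card_range, smul_eq_mul] at this
    exact Nat.le_of_dvd (Nat.factorial_pos _) this
  have h₂ := factorial_sum_le_card_pow_mul_prod_factorial (Finset.range b) (fun _ ↦ N)
  simp only [Finset.prod_const, Finset.sum_const, Finset.card_range, smul_eq_mul] at h₂
  calc M.factorial ^ A ≤ (b * N).factorial := h₁.trans (Nat.factorial_le h)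
    _ ≤ b ^ (b * N) * N.factorial ^ b := h₂
    _ = (b ^ N * N.factorial) ^ b := by rw [mul_pow, ← pow_mul, mul_comm b N]

theorem factorial_add_le_two_pow_mul (S D : ℕ) :
    (S + D).factorial ≤ 2 ^ (S + D) * (S.factorial * D.factorial) := by
  rw [← Nat.add_choose_mul_factorial_mul_factorial S D, mul_assoc]
  gcongr
  exact Nat.choose_le_two_pow _ _

/-- If the weights satisfy `1 ≤ a i ≤ b` on `s` and `∑ a i * m i + D = j + A * M`, then `M!`
raised to the power `A / b` is at most geometrically larger than `D! * ∏ (m i)!`. -/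
theorem factorial_pow_le_of_weighted_sum_eq {ι : Type*} {s : Finset ι} (hs : s.Nonempty)
    {a m : ι → ℕ} {A M D b j : ℕ} (ha : ∀ i ∈ s, 1 ≤ a i) (hab : ∀ i ∈ s, a i ≤ b) (hb : 1 ≤ b)
    (h : ∑ i ∈ s, a i * m i + D = j + A * M) :
    M.factorial ^ A ≤ (((2 * b * s.card) ^ (j + A)) ^ M *
      ((∏ i ∈ s, (m i).factorial) * D.factorial)) ^ b := by
  have hP : 0 < ∏ i ∈ s, (m i).factorial := Finset.prod_pos fun i _ ↦ Nat.factorial_pos _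
  have hD := Nat.factorial_pos D
  have hk : 0 < s.card := hs.card_pos
  rcases Nat.eq_zero_or_pos M with rfl | hM
  · simpa using Nat.one_le_pow _ _ (Nat.mul_pos hP hD)
  set S := ∑ i ∈ s, m i with hS
  have hle : S ≤ ∑ i ∈ s, a i * m i :=
    Finset.sum_le_sum fun i hi ↦ Nat.le_mul_of_pos_left _ (ha i hi)
  have hge : ∑ i ∈ s, a i * m i ≤ b * S := by
    rw [hS, Finset.mul_sum]
    exact Finset.sum_le_sum fun i hi ↦ Nat.mul_le_mul_right _ (hab i hi)
  have hDb : D ≤ b * D := Nat.le_mul_of_pos_left _ hb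
  have hAM : A * M ≤ b * (S + D) := by rw [mul_add]; omega
  have hN : S + D ≤ (j + A) * M := by
    have := Nat.le_mul_of_pos_right j hM
    rw [add_mul]; omega
  refine (factorial_pow_le_of_mul_le hAM).trans (Nat.pow_le_pow_left ?_ b)
  calc b ^ (S + D) * (S + D).factorial
      ≤ b ^ (S + D) * (2 ^ (S + D) *
          ((s.card ^ S * ∏ i ∈ s, (m i).factorial) * D.factorial)) := by
        gcongr
        refine (factorial_add_le_two_pow_mul S D).trans ?_
        gcongr
        exact factorial_sum_le_card_pow_mul_prod_factorial s m
    _ ≤ b ^ (S + D) * (2 ^ (S + D) *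
          ((s.card ^ (S + D) * ∏ i ∈ s, (m i).factorial) * D.factorial)) := by
        gcongr
        omega
    _ = (2 * b * s.card) ^ (S + D) * ((∏ i ∈ s, (m i).factorial) * D.factorial) := by
        rw [mul_pow, mul_pow]; ring
    _ ≤ ((2 * b * s.card) ^ (j + A)) ^ M * ((∏ i ∈ s, (m i).factorial) * D.factorial) := by
        rw [← pow_mul]
        gcongr
        exact Nat.mul_pos (by omega) hk

/-- the key factorial estimate for the Gevrey order of the Γ-series
`φ_{v^j}` of `M_{(1 a_2 ⋯ a_n)}(β)`: for `n ≥ 4`, integers `1 < a_2 < ⋯ < a_{n−1}`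
and `j ∈ ℕ`, there are `C, r > 0` such that for all `m_2,…,m_{n−2},m_{n−1} ∈ ℕ` with
`Σ_{i=2}^{n−2} a_i m_i ≤ j + a_{n−1} m_{n−1}` one has
`m_{n−1}!/(m_2!⋯m_{n−2}!·(j + a_{n−1}m_{n−1} − Σ a_i m_i)!) ≤ C^{m_{n−1}}/(m_{n−1}!)^r`. -/
theorem factorial_estimate (n : ℕ) (hn : 4 ≤ n) (a : ℕ → ℕ) (ha2 : 1 < a 2)
    (hmono : ∀ i : ℕ, 2 ≤ i → i + 1 ≤ n - 1 → a i < a (i + 1)) (j : ℕ) :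
    ∃ C r : ℝ, 0 < C ∧ 0 < r ∧
      ∀ m : ℕ → ℕ,
        (∑ i ∈ Finset.Icc 2 (n - 2), a i * m i) ≤ j + a (n - 1) * m (n - 1) →
        ((m (n - 1)).factorial : ℝ) /
            ((∏ i ∈ Finset.Icc 2 (n - 2), (m i).factorial : ℕ) : ℝ) /
            (((j + a (n - 1) * m (n - 1) -
                ∑ i ∈ Finset.Icc 2 (n - 2), a i * m i).factorial : ℕ) : ℝ)
          ≤ C ^ (m (n - 1)) / ((m (n - 1)).factorial : ℝ) ^ r := by
  have hmon : ∀ i k : ℕ, 2 ≤ i → i + k ≤ n - 1 → a i ≤ a (i + k) := by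
    intro i k hi
    induction k with
    | zero => simp
    | succ k ih =>
      intro hk
      exact (ih (by omega)).trans (hmono (i + k) (by omega) (by omega)).le
  set A := a (n - 1)
  set b := a (n - 2)
  set s := Finset.Icc 2 (n - 2)
  have hbA : b < A := by
    have := hmono (n - 2) (by omega) (by omega)
    rwa [show n - 2 + 1 = n - 1 by omega] at this
  have hlow : ∀ i ∈ s, 1 ≤ a i := fun i hi ↦ by
    obtain ⟨h₁, h₂⟩ := Finset.mem_Icc.1 hi
    have := hmon 2 (i - 2) le_rfl (by omega)
    rw [show 2 + (i - 2) = i by omega] at this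
    omega
  have hupp : ∀ i ∈ s, a i ≤ b := fun i hi ↦ by
    obtain ⟨h₁, h₂⟩ := Finset.mem_Icc.1 hi
    have := hmon i (n - 2 - i) h₁ (by omega)
    rwa [show i + (n - 2 - i) = n - 2 by omega] at this
  have hs : s.Nonempty := ⟨2, Finset.mem_Icc.2 ⟨le_rfl, by omega⟩⟩
  have hb : 1 ≤ b := hlow (n - 2) (Finset.mem_Icc.2 ⟨by omega, le_rfl⟩)
  have hb' : (0 : ℝ) < b := by exact_mod_cast hb
  have hr : (0 : ℝ) < (A : ℝ) / b - 1 := by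
    rw [sub_pos, one_lt_div hb']
    exact_mod_cast hbA
  have hC : 0 < (2 * b * s.card) ^ (j + A) :=
    pow_pos (Nat.mul_pos (by omega) hs.card_pos) _
  refine ⟨((2 * b * s.card) ^ (j + A) : ℕ), (A : ℝ) / b - 1, by exact_mod_cast hC, hr, ?_⟩
  intro m hm
  set M := m (n - 1)
  set D := j + A * M - ∑ i ∈ s, a i * m i
  have key := factorial_pow_le_of_weighted_sum_eq (m := m) (M := M) (D := D) (A := A) (j := j)
    hs hlow hupp hb (by omega)
  set P := ∏ i ∈ s, (m i).factorial
  have hP : (0 : ℝ) < P := by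
    exact_mod_cast Finset.prod_pos fun i _ ↦ Nat.factorial_pos (m i)
  have hD : (0 : ℝ) < D.factorial := by exact_mod_cast Nat.factorial_pos D
  have hM : (0 : ℝ) < M.factorial := by exact_mod_cast Nat.factorial_pos M
  set C := (2 * b * s.card) ^ (j + A)
  have key' : (M.factorial : ℝ) ^ A ≤ ((C : ℝ) ^ M * (P * D.factorial)) ^ b := by
    exact_mod_cast key
  have hroot : (M.factorial : ℝ) ^ ((A : ℝ) / b) ≤ (C : ℝ) ^ M * (P * D.factorial) := by
    rw [← Real.rpow_natCast, ← Real.rpow_natCast _ b] at key'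
    rw [div_eq_mul_inv, Real.rpow_mul hM.le]
    exact (Real.rpow_inv_le_iff_of_pos (by positivity) (by positivity) hb').2 key'
  rw [div_div, div_le_div_iff₀ (by positivity) (by positivity)]
  calc (M.factorial : ℝ) * (M.factorial : ℝ) ^ ((A : ℝ) / b - 1)
      = (M.factorial : ℝ) ^ ((A : ℝ) / b) := by
        rw [Real.rpow_sub_one hM.ne']
        field_simp
    _ ≤ _ := hroot
end

section
/- Let a < b be integers with 1 < a < b, and set c_m := (bm)!/(am)! for m ∈ ℕ. Then for real s, the power series Σ_{m≥0} (c_m/((am)!)^{s−1}) z^m has positive radius of convergence if and only if s ≥ b/a; in particular the series Σ_m (−1)^{bm} ((bm)!/(am)!) z^m (which arises as a subsum of the Γ-series φ_{ṽ^q} of the system M_{(1 a_2 ⋯ a_n)}(β) with a = a_{n−1}, b = a_n, in the variable z = x_n^{a_{n−1}}/x_{n−1}^{a_n}) has Gevrey index exactly b/a. -/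
/-- The elementary form of Stirling's lower bound: `n log n - n ≤ log n!`. -/
theorem mul_log_sub_le_log_factorial (n : ℕ) :
    (n : ℝ) * Real.log n - n ≤ Real.log (n.factorial : ℝ) := by
  rcases Nat.eq_zero_or_pos n with rfl | hn
  · simp
  have hn' : (0 : ℝ) < n := by exact_mod_cast hn
  have hf : (0 : ℝ) < n.factorial := by exact_mod_cast n.factorial_pos
  have h := Real.log_le_log (by positivity) (Real.pow_div_factorial_le_exp (n : ℝ) hn'.le n)
  rw [Real.log_exp, Real.log_div (by positivity) hf.ne', Real.log_pow] at h
  linarith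

/-- The trivial upper bound `log n! ≤ n log n`. -/
theorem log_factorial_le_mul_log (n : ℕ) :
    Real.log (n.factorial : ℝ) ≤ n * Real.log n := by
  have h := Real.log_le_log (by exact_mod_cast n.factorial_pos)
    (by exact_mod_cast Nat.factorial_le_pow n : (n.factorial : ℝ) ≤ (n : ℝ) ^ n)
  rwa [Real.log_pow] at h

theorem log_factorial_nonneg (n : ℕ) : 0 ≤ Real.log (n.factorial : ℝ) :=
  Real.log_nonneg (by exact_mod_cast n.factorial_pos)

/-- The logarithmic form of the general term of the series. -/
theorem factorial_div_rpow_mul_pow_eq_exp (k l m : ℕ) (s : ℝ) {r : ℝ} (hr : 0 < r) :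
    ((k.factorial : ℝ) / (l.factorial : ℝ)) / (l.factorial : ℝ) ^ (s - 1) * r ^ m =
      Real.exp (Real.log k.factorial - s * Real.log l.factorial + m * Real.log r) := by
  have hk : (0 : ℝ) < k.factorial := by exact_mod_cast k.factorial_pos
  have hl : (0 : ℝ) < l.factorial := by exact_mod_cast l.factorial_pos
  rw [← Real.exp_log (show 0 < ((k.factorial : ℝ) / (l.factorial : ℝ)) /
    (l.factorial : ℝ) ^ (s - 1) * r ^ m by positivity)]
  rw [Real.log_mul (by positivity) (by positivity), Real.log_div (by positivity) (by positivity),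
    Real.log_div hk.ne' hl.ne', Real.log_rpow hl, Real.log_pow]
  ring_nf

/-- Above the critical slope the logarithm of the coefficients grows at most linearly. -/
theorem log_factorial_sub_le {a b : ℕ} (ha : 0 < a) (hb : 0 < b) {s : ℝ}
    (hs : (b : ℝ) / a ≤ s) (m : ℕ) :
    Real.log (b * m).factorial - s * Real.log (a * m).factorial ≤
      m * (b * (Real.log b - Real.log a + 1)) := by
  rcases Nat.eq_zero_or_pos m with rfl | hm
  · simp
  have ha' : (0 : ℝ) < a := by exact_mod_cast ha
  have hb' : (0 : ℝ) < b := by exact_mod_cast hb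
  have hm' : (0 : ℝ) < m := by exact_mod_cast hm
  have hB := log_factorial_le_mul_log (b * m)
  have hA := mul_log_sub_le_log_factorial (a * m)
  push_cast at hB hA
  rw [Real.log_mul hb'.ne' hm'.ne'] at hB
  rw [Real.log_mul ha'.ne' hm'.ne'] at hA
  have h₁ := mul_le_mul_of_nonneg_right hs (log_factorial_nonneg (a * m))
  have h₂ := mul_le_mul_of_nonneg_left hA (by positivity : 0 ≤ (b : ℝ) / a)
  have h₃ : (b : ℝ) / a * (a * m * (Real.log a + Real.log m) - a * m) =
      b * m * (Real.log a + Real.log m) - b * m := by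
    field_simp
  linarith

/-- Below the critical slope the logarithm of the coefficients grows at least like `m log m`. -/
theorem le_log_factorial_sub {a b : ℕ} (ha : 0 < a) (hb : 0 < b) (s : ℝ) {m : ℕ} (hm : 0 < m) :
    m * ((b - max s 0 * a) * Real.log m + (b * Real.log b - b - max s 0 * a * Real.log a)) ≤
      Real.log (b * m).factorial - s * Real.log (a * m).factorial := by
  have ha' : (0 : ℝ) < a := by exact_mod_cast ha
  have hb' : (0 : ℝ) < b := by exact_mod_cast hb
  have hm' : (0 : ℝ) < m := by exact_mod_cast hm
  have hB := mul_log_sub_le_log_factorial (b * m)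
  have hA := log_factorial_le_mul_log (a * m)
  push_cast at hB hA
  rw [Real.log_mul hb'.ne' hm'.ne'] at hB
  rw [Real.log_mul ha'.ne' hm'.ne'] at hA
  have h₁ := mul_le_mul_of_nonneg_right (le_max_left s 0) (log_factorial_nonneg (a * m))
  have h₂ := mul_le_mul_of_nonneg_left hA (le_max_right s 0)
  linarith


/-- for integers `1 < a < b` and `c_m = (bm)!/(am)!`, the series
`Σ_m (c_m/((am)!)^{s−1}) z^m` has positive radius of convergence if and only if
`s ≥ b/a`; hence the subsum `Σ_m (−1)^{bm}((bm)!/(am)!) z^m` of the Γ-series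
`φ_{ṽ^q}` (with `a = a_{n−1}`, `b = a_n`, `z = x_n^{a_{n−1}}/x_{n−1}^{a_n}`) has
Gevrey index exactly `b/a` along `x_n = 0`. -/
theorem gevrey_index_of_factorial_quotient (a b : ℕ) (ha : 1 < a) (hab : a < b) :
    ∀ s : ℝ,
      (∃ r : ℝ, 0 < r ∧ Summable (fun m : ℕ =>
        (((b * m).factorial : ℝ) / ((a * m).factorial : ℝ)) /
            ((a * m).factorial : ℝ) ^ (s - 1) * r ^ m))
      ↔ (b : ℝ) / (a : ℝ) ≤ s := by
  have ha0 : 0 < a := by omega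
  have hb0 : 0 < b := by omega
  have ha' : (0 : ℝ) < a := by exact_mod_cast ha0
  have hb' : (0 : ℝ) < b := by exact_mod_cast hb0
  intro s
  constructor
  · rintro ⟨r, hr, hsum⟩
    by_contra! hs
    have hmax : 0 < (b : ℝ) - max s 0 * a := by
      have h : max s 0 < (b : ℝ) / a := max_lt hs (by positivity)
      rw [lt_div_iff₀ ha'] at h
      linarith
    have hlog : Filter.Tendsto (fun m : ℕ => (b - max s 0 * a) * Real.log (m : ℝ))
        Filter.atTop Filter.atTop :=
      (Real.tendsto_log_atTop.comp tendsto_natCast_atTop_atTop).const_mul_atTop hmax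
    have hlt := hsum.tendsto_atTop_zero.eventually (gt_mem_nhds one_pos)
    obtain ⟨m, hm, hge, hm0⟩ := (hlt.and ((hlog.eventually_ge_atTop
      (-(b * Real.log b - b - max s 0 * a * Real.log a) - Real.log r)).and
      (Filter.eventually_gt_atTop 0))).exists
    rw [factorial_div_rpow_mul_pow_eq_exp _ _ _ _ hr, Real.exp_lt_one_iff] at hm
    have h₁ := le_log_factorial_sub ha0 hb0 s hm0
    have h₂ : 0 ≤ (m : ℝ) * ((b - max s 0 * a) * Real.log m +
        (b * Real.log b - b - max s 0 * a * Real.log a) + Real.log r) :=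
      mul_nonneg m.cast_nonneg (by linarith)
    linarith
  · intro hs
    set C : ℝ := b * (Real.log b - Real.log a + 1)
    refine ⟨Real.exp (-C - 1), Real.exp_pos _, ?_⟩
    refine Summable.of_nonneg_of_le (fun m => by positivity) (fun m => ?_)
      (summable_geometric_of_lt_one (Real.exp_pos (-1)).le
        (Real.exp_lt_one_iff.2 (by norm_num)))
    rw [factorial_div_rpow_mul_pow_eq_exp _ _ _ _ (Real.exp_pos _), Real.log_exp,
      ← Real.exp_nat_mul, Real.exp_le_exp]
    have h := log_factorial_sub_le ha0 hb0 hs m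
    linarith
end
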